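/- In the Hawaiian homology sequence (G_k, f_k), for every k ∈ ℕ the image of the projection π_k from the inverse limit L to G_k equals the subgroup W_k := {h ∈ G_k : h(3k+1) = h(3k+2) = h(3k+3)}; consequently the real error E_k = G_k / π_k(L) is isomorphic to ℤ². -/

import Mathlib

/-- The bonding homomorphism `f_k : G_{k+1} → G_k` of the Hawaiian homology sequence,
where `G_k = (Fin (3k+4) → ℤ)`: `(f_k h)(i) = h(i)` for `i ≤ 3k` and
`(f_k h)(3k+1) = (f_k h)(3k+2) = (f_k h)(3k+3) = h(3k+1)`. -/
def hawF (k : ℕ) : (Fin (3 * (k + 1) + 4) → ℤ) →+ (Fin (3 * k + 4) → ℤ) where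
  toFun h := fun i =>
    if (i : ℕ) ≤ 3 * k then h ⟨(i : ℕ), by omega⟩ else h ⟨3 * k + 1, by omega⟩
  map_zero' := by
    funext i
    by_cases hi : (i : ℕ) ≤ 3 * k <;> simp [hi]
  map_add' a b := by
    funext i
    by_cases hi : (i : ℕ) ≤ 3 * k <;> simp [hi]

/-- The inverse limit `L` of the Hawaiian homology sequence: the subgroup of threads. -/
def hawLimit : AddSubgroup (∀ k : ℕ, Fin (3 * k + 4) → ℤ) where
  carrier := {s | ∀ k : ℕ, hawF k (s (k + 1)) = s k}
  zero_mem' := fun k => by simp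
  add_mem' := fun {a b} ha hb k => by simp [ha k, hb k]
  neg_mem' := fun {a} ha k => by simp [ha k]

/-- The subgroup `W_k = {h ∈ G_k : h(3k+1) = h(3k+2) = h(3k+3)}`. -/
def hawW (k : ℕ) : AddSubgroup (Fin (3 * k + 4) → ℤ) where
  carrier := {h | h ⟨3 * k + 1, by omega⟩ = h ⟨3 * k + 2, by omega⟩ ∧
    h ⟨3 * k + 2, by omega⟩ = h ⟨3 * k + 3, by omega⟩}
  zero_mem' := ⟨rfl, rfl⟩
  add_mem' := fun {a b} ha hb =>
    ⟨by simp only [Pi.add_apply, ha.1, hb.1], by simp only [Pi.add_apply, ha.2, hb.2]⟩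
  neg_mem' := fun {a} ha =>
    ⟨by simp only [Pi.neg_apply, ha.1], by simp only [Pi.neg_apply, ha.2]⟩

/-- The thread of the Hawaiian homology sequence determined by an integer sequence `x`. -/
def hawThread (x : ℕ → ℤ) (n : ℕ) : Fin (3 * n + 4) → ℤ :=
  fun i => x (min (i : ℕ) (3 * n + 1))

theorem hawThread_mem_hawLimit (x : ℕ → ℤ) : hawThread x ∈ hawLimit := by
  intro n
  funext i
  by_cases hi : (i : ℕ) ≤ 3 * n
  · simp only [hawF, AddMonoidHom.coe_mk, ZeroHom.coe_mk, hawThread, hi, if_true]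
    congr 1
    omega
  · simp only [hawF, AddMonoidHom.coe_mk, ZeroHom.coe_mk, hawThread, hi, if_false]
    congr 1
    omega

theorem hawF_mem_hawW (k : ℕ) (h : Fin (3 * (k + 1) + 4) → ℤ) : hawF k h ∈ hawW k := by
  constructor <;> simp [hawF]

theorem exists_hawThread_eq {k : ℕ} {h : Fin (3 * k + 4) → ℤ} (hh : h ∈ hawW k) :
    ∃ x, hawThread x k = h := by
  obtain ⟨h₁₂, h₂₃⟩ := hh
  refine ⟨fun n => h ⟨min n (3 * k + 1), by omega⟩, funext fun ⟨i, hi⟩ => ?_⟩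
  obtain hi | rfl | rfl : i ≤ 3 * k + 1 ∨ i = 3 * k + 2 ∨ i = 3 * k + 3 := by omega
  · simp [hawThread, hi]
  · simpa [hawThread] using h₁₂
  · simpa [hawThread] using h₁₂.trans h₂₃

theorem map_eval_hawLimit (k : ℕ) :
    AddSubgroup.map (Pi.evalAddMonoidHom (fun k : ℕ => Fin (3 * k + 4) → ℤ) k) hawLimit =
      hawW k := by
  ext h
  constructor
  · rintro ⟨s, hs, rfl⟩
    simpa only [Pi.evalAddMonoidHom_apply, hs k] using hawF_mem_hawW k (s (k + 1))
  · intro hh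
    obtain ⟨x, hx⟩ := exists_hawThread_eq hh
    exact ⟨hawThread x, hawThread_mem_hawLimit x, hx⟩

/-- The two successive differences of the last three coordinates. -/
def hawDiff (k : ℕ) : (Fin (3 * k + 4) → ℤ) →+ ℤ × ℤ where
  toFun h := (h ⟨3 * k + 1, by omega⟩ - h ⟨3 * k + 2, by omega⟩,
    h ⟨3 * k + 2, by omega⟩ - h ⟨3 * k + 3, by omega⟩)
  map_zero' := by simp
  map_add' a b := by
    ext <;> simp only [Pi.add_apply, Prod.mk_add_mk] <;> ring

theorem ker_hawDiff (k : ℕ) : (hawDiff k).ker = hawW k := by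
  ext h
  simp [AddMonoidHom.mem_ker, hawDiff, hawW, Prod.ext_iff, sub_eq_zero]

theorem hawDiff_surjective (k : ℕ) : Function.Surjective (hawDiff k) := by
  rintro ⟨a, b⟩
  refine ⟨fun i => if (i : ℕ) = 3 * k + 1 then a else if (i : ℕ) = 3 * k + 3 then -b else 0, ?_⟩
  simp [hawDiff]

/-- In the Hawaiian homology sequence, for every `k` the image of the projection `π_k` from
the inverse limit `L` to `G_k` equals `W_k`; consequently the real error
`E_k = G_k / π_k(L)` is isomorphic to `ℤ²`. -/
theorem hawLimit_proj_eq_hawW :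
    ∀ k : ℕ,
      AddSubgroup.map (Pi.evalAddMonoidHom (fun k : ℕ => Fin (3 * k + 4) → ℤ) k) hawLimit =
        hawW k ∧
      Nonempty
        (((Fin (3 * k + 4) → ℤ) ⧸
            AddSubgroup.map (Pi.evalAddMonoidHom (fun k : ℕ => Fin (3 * k + 4) → ℤ) k)
              hawLimit) ≃+ ℤ × ℤ) := by
  intro k
  have e := (QuotientAddGroup.quotientAddEquivOfEq
    ((map_eval_hawLimit k).trans (ker_hawDiff k).symm)).trans
      (QuotientAddGroup.quotientKerEquivOfSurjective (hawDiff k) (hawDiff_surjective k))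
  exact ⟨map_eval_hawLimit k, ⟨e⟩⟩
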